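/- A finite simple connected graph G with at least one edge has exactly two Q-main eigenvalues if and only if there exists a unique pair of integers (a, b) such that for every vertex v of G, ∑_{u ∈ N(v)} d(u) = a·d(v) + b − d(v)², where d(x) denotes the degree of x in G and N(v) the set of neighbors of v. -/

import Mathlib

open Finset

variable {V : Type*}

/-- The signless Laplacian matrix `Q(G) = D(G) + A(G)` of a simple graph. -/
noncomputable def signlessLaplacian [Fintype V] [DecidableEq V] (G : SimpleGraph V)
    [DecidableRel G.Adj] : Matrix V V ℝ :=
  Matrix.diagonal (fun v => (G.degree v : ℝ)) + G.adjMatrix ℝ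

/-- `μ` is a `Q`-main eigenvalue of `G` if it has an eigenvector of `Q(G)` whose
entry sum is nonzero. -/
def IsQMainEigenvalue [Fintype V] [DecidableEq V] (G : SimpleGraph V)
    [DecidableRel G.Adj] (μ : ℝ) : Prop :=
  ∃ x : V → ℝ, (signlessLaplacian G).mulVec x = μ • x ∧ ∑ v, x v ≠ 0

open Matrix

section QMain

variable [Fintype V] [DecidableEq V] {G : SimpleGraph V} [DecidableRel G.Adj]

lemma signlessLaplacian_mulVec_apply (x : V → ℝ) (v : V) :
    (signlessLaplacian G *ᵥ x) v = G.degree v * x v + ∑ u ∈ G.neighborFinset v, x u := by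
  simp [signlessLaplacian, add_mulVec, mulVec_diagonal, SimpleGraph.adjMatrix_mulVec_apply]

lemma signlessLaplacian_mulVec_one :
    signlessLaplacian G *ᵥ 1 = (2 : ℝ) • fun v => (G.degree v : ℝ) := by
  ext v
  simp [signlessLaplacian_mulVec_apply, two_mul]

lemma signlessLaplacian_isSymm : (signlessLaplacian G).IsSymm :=
  (isSymm_diagonal _).add (G.isSymm_adjMatrix)

lemma sum_signlessLaplacian_mulVec (x : V → ℝ) :
    ∑ v, (signlessLaplacian G *ᵥ x) v = 2 * ∑ v, G.degree v * x v := by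
  have h : 1 ⬝ᵥ signlessLaplacian G *ᵥ x = (signlessLaplacian G *ᵥ 1) ⬝ᵥ x := by
    rw [dotProduct_mulVec, ← mulVec_transpose, signlessLaplacian_isSymm.eq]
  rw [signlessLaplacian_mulVec_one] at h
  simpa [dotProduct, Finset.mul_sum, mul_assoc] using h

/-- A `Q`-main eigenvalue of a regular graph is twice its degree. -/
lemma IsQMainEigenvalue.eq_of_regular {μ k : ℝ} (hμ : IsQMainEigenvalue G μ)
    (hk : ∀ v, (G.degree v : ℝ) = k) : μ = 2 * k := by
  obtain ⟨x, hx, hs⟩ := hμ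
  have h := sum_signlessLaplacian_mulVec (G := G) x
  rw [hx] at h
  simp only [hk, Pi.smul_apply, smul_eq_mul, ← Finset.mul_sum] at h
  exact mul_right_cancel₀ hs (by linarith)

lemma IsQMainEigenvalue.sq_eq {μ a b : ℝ} (hμ : IsQMainEigenvalue G μ)
    (h : ∀ v, (signlessLaplacian G *ᵥ fun v => (G.degree v : ℝ)) v = a * G.degree v + b) :
    μ ^ 2 = a * μ + 2 * b := by
  obtain ⟨x, hx, hs⟩ := hμ
  have h₁ := sum_signlessLaplacian_mulVec (G := G) x
  have h₂ : (fun v => (G.degree v : ℝ)) ⬝ᵥ signlessLaplacian G *ᵥ x =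
      (signlessLaplacian G *ᵥ fun v => (G.degree v : ℝ)) ⬝ᵥ x := by
    rw [dotProduct_mulVec, ← mulVec_transpose, signlessLaplacian_isSymm.eq]
  rw [hx] at h₁ h₂
  simp only [dotProduct, h, Pi.smul_apply, smul_eq_mul, add_mul, mul_left_comm _ μ, mul_assoc,
    Finset.sum_add_distrib, ← Finset.mul_sum] at h₁ h₂
  refine mul_right_cancel₀ hs ?_
  linear_combination (μ - a) * h₁ + 2 * h₂

lemma IsQMainEigenvalue.isIntegral {μ : ℝ} (hμ : IsQMainEigenvalue G μ) : IsIntegral ℤ μ := by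
  obtain ⟨x, hx, hs⟩ := hμ
  let M : Matrix V V ℤ := diagonal (fun v => (G.degree v : ℤ)) + G.adjMatrix ℤ
  have hM : M.map (Int.castRingHom ℝ) = signlessLaplacian G := by
    ext i j
    simp only [M, signlessLaplacian, map_apply, Matrix.add_apply, diagonal_apply,
      SimpleGraph.adjMatrix_apply]
    split_ifs <;> simp
  refine ⟨M.charpoly, M.charpoly_monic, ?_⟩
  rw [← Polynomial.eval_map, algebraMap_int_eq, ← charpoly_map, hM, eval_charpoly]
  refine exists_mulVec_eq_zero_iff.mp ⟨x, ?_, ?_⟩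
  · rintro rfl
    simp at hs
  · simp [sub_mulVec, hx, scalar_apply, ← smul_one_eq_diagonal, smul_mulVec]

lemma exists_sum_eq_one_isQMainEigenvalue (G : SimpleGraph V) [DecidableRel G.Adj] :
    ∃ (w : V → V → ℝ) (l : V → ℝ), ∑ i, w i = 1 ∧
      ∀ i, signlessLaplacian G *ᵥ w i = l i • w i ∧ (w i ≠ 0 → IsQMainEigenvalue G (l i)) := by
  have hA : (signlessLaplacian G).IsHermitian := by
    rw [IsHermitian, conjTranspose_eq_transpose_of_trivial, signlessLaplacian_isSymm.eq]
  let c : V → ℝ := fun i => inner ℝ (hA.eigenvectorBasis i) (WithLp.toLp 2 1)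
  have hc (i : V) : c i = ∑ v, hA.eigenvectorBasis i v := by
    simp [c, PiLp.inner_apply]
  refine ⟨fun i => c i • ⇑(hA.eigenvectorBasis i), hA.eigenvalues, ?_, fun i => ⟨?_, fun h => ?_⟩⟩
  · have h := congrArg WithLp.ofLp (hA.eigenvectorBasis.sum_repr' (WithLp.toLp 2 1))
    simpa [WithLp.ofLp_sum] using h
  · rw [mulVec_smul, hA.mulVec_eigenvectorBasis, smul_comm]
  · refine ⟨_, hA.mulVec_eigenvectorBasis i, ?_⟩
    rw [← hc]
    intro h₀
    simp [h₀] at h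

/-- A graph all of whose `Q`-main eigenvalues are equal to `μ` is regular. -/
lemma degree_eq_of_forall_isQMainEigenvalue_eq {μ : ℝ}
    (h : ∀ l, IsQMainEigenvalue G l → l = μ) (v : V) : (G.degree v : ℝ) = μ / 2 := by
  obtain ⟨w, l, hw, hl⟩ := exists_sum_eq_one_isQMainEigenvalue G
  have key : signlessLaplacian G *ᵥ 1 = μ • 1 := by
    rw [← hw, mulVec_sum, Finset.smul_sum]
    refine Finset.sum_congr rfl fun i _ => ?_
    rw [(hl i).1]
    by_cases h₀ : w i = 0
    · simp [h₀]
    · rw [h _ ((hl i).2 h₀)]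
  have := congrFun (signlessLaplacian_mulVec_one.symm.trans key) v
  simp only [Pi.smul_apply, smul_eq_mul, Pi.one_apply] at this
  linarith

lemma signlessLaplacian_mulVec_degree_of_forall_eq_or_eq {μ ν : ℝ}
    (h : ∀ l, IsQMainEigenvalue G l → l = μ ∨ l = ν) (v : V) :
    (signlessLaplacian G *ᵥ fun v => (G.degree v : ℝ)) v =
      (μ + ν) * G.degree v - μ * ν / 2 := by
  obtain ⟨w, l, hw, hl⟩ := exists_sum_eq_one_isQMainEigenvalue G
  have key : signlessLaplacian G *ᵥ (signlessLaplacian G *ᵥ 1) =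
      (μ + ν) • signlessLaplacian G *ᵥ 1 - (μ * ν) • 1 := by
    simp only [← hw, mulVec_sum, Finset.smul_sum, ← Finset.sum_sub_distrib]
    refine Finset.sum_congr rfl fun i _ => ?_
    simp only [(hl i).1, mulVec_smul, smul_smul, ← sub_smul]
    by_cases h₀ : w i = 0
    · simp [h₀]
    · congr 1
      rcases h _ ((hl i).2 h₀) with h₁ | h₁ <;> rw [h₁] <;> ring
  rw [signlessLaplacian_mulVec_one, mulVec_smul] at key
  have := congrFun key v
  simp only [Pi.smul_apply, Pi.sub_apply, smul_eq_mul, Pi.one_apply] at this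
  linarith

lemma sum_degree_neighborFinset_eq_iff (a b : ℤ) (v : V) :
    (∑ u ∈ G.neighborFinset v, (G.degree u : ℤ)) = a * G.degree v + b - (G.degree v : ℤ) ^ 2 ↔
      (signlessLaplacian G *ᵥ fun v => (G.degree v : ℝ)) v = a * G.degree v + b := by
  rw [signlessLaplacian_mulVec_apply, ← @Int.cast_inj ℝ]
  push_cast
  constructor <;> intro h <;> linarith

lemma exists_eq_intCast_of_isIntegral_of_mul_eq {s : ℝ} (hs : IsIntegral ℤ s) {m n : ℤ}
    (hm : m ≠ 0) (h : s * m = n) : ∃ a : ℤ, s = a := by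
  have hq : s = algebraMap ℚ ℝ (n / m) := by
    have : (m : ℝ) ≠ 0 := by exact_mod_cast hm
    simp only [eq_ratCast, Rat.cast_div, Rat.cast_intCast]
    field_simp
    exact h
  rw [hq, isIntegral_algebraMap_iff (algebraMap ℚ ℝ).injective,
    IsIntegrallyClosed.isIntegral_iff] at hs
  obtain ⟨a, ha⟩ := hs
  exact ⟨a, by rw [hq, ← ha]; simp⟩

end QMain

/-- A finite simple connected graph with at least one edge has exactly two `Q`-main
eigenvalues iff there is a unique pair of integers `(a, b)` such that
`∑_{u ∈ N(v)} d(u) = a·d(v) + b − d(v)²` for every vertex `v`. -/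
theorem exactly_two_QMain_iff_unique_pair [Fintype V] [DecidableEq V] (G : SimpleGraph V)
    [DecidableRel G.Adj] (hconn : G.Connected) (hedge : G.edgeSet.Nonempty) :
    {μ : ℝ | IsQMainEigenvalue G μ}.ncard = 2 ↔
      ∃! p : ℤ × ℤ, ∀ v : V,
        (∑ u ∈ G.neighborFinset v, (G.degree u : ℤ)) =
          p.1 * (G.degree v : ℤ) + p.2 - (G.degree v : ℤ) ^ 2 := by
  constructor
  · intro h
    obtain ⟨μ, ν, hne, hset⟩ := Set.ncard_eq_two.mp h
    have hmem (l : ℝ) : IsQMainEigenvalue G l ↔ l = μ ∨ l = ν := by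
      simpa using Set.ext_iff.mp hset l
    have hμ := (hmem μ).2 (Or.inl rfl)
    have hν := (hmem ν).2 (Or.inr rfl)
    have hQ := signlessLaplacian_mulVec_degree_of_forall_eq_or_eq fun l => (hmem l).1
    obtain ⟨v₀⟩ := hconn.nonempty
    obtain ⟨v, hv⟩ : ∃ v, G.degree v ≠ G.degree v₀ := by
      by_contra! hreg
      have hk (v : V) : (G.degree v : ℝ) = G.degree v₀ := by rw [hreg v]
      exact hne ((hμ.eq_of_regular hk).trans (hν.eq_of_regular hk).symm)
    have hv' : (G.degree v : ℤ) - G.degree v₀ ≠ 0 := by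
      rw [sub_ne_zero]
      exact_mod_cast hv
    have hint (u : V) : ∃ n : ℤ, (n : ℝ) = (μ + ν) * G.degree u - μ * ν / 2 :=
      ⟨G.degree u * G.degree u + ∑ w ∈ G.neighborFinset u, G.degree w, by
        rw [← hQ, signlessLaplacian_mulVec_apply]
        push_cast
        rfl⟩
    obtain ⟨n, hn⟩ := hint v
    obtain ⟨n₀, hn₀⟩ := hint v₀
    obtain ⟨a, ha⟩ := exists_eq_intCast_of_isIntegral_of_mul_eq
      (hμ.isIntegral.add hν.isIntegral) (n := n - n₀) hv' (by push_cast; linarith)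
    refine ⟨(a, n₀ - a * G.degree v₀), fun u => ?_, fun p hp => ?_⟩
    · refine (sum_degree_neighborFinset_eq_iff _ _ _).2 ?_
      rw [hQ, ha]
      rw [ha] at hn₀
      push_cast
      linarith
    · have hp' (u : V) := (sum_degree_neighborFinset_eq_iff _ _ _).1 (hp u)
      have h₀ : (n₀ : ℝ) = p.1 * G.degree v₀ + p.2 := by rw [hn₀, ← hQ, hp']
      have h₁ : (n : ℝ) = p.1 * G.degree v + p.2 := by rw [hn, ← hQ, hp']
      rw [ha] at hn hn₀
      have h₂ : (p.1 - a : ℝ) * (G.degree v - G.degree v₀) = 0 := by linarith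
      have h₃ : p.1 = a := by
        have : (p.1 - a) * ((G.degree v : ℤ) - G.degree v₀) = 0 := by exact_mod_cast h₂
        exact sub_eq_zero.mp ((mul_eq_zero.mp this).resolve_right hv')
      have h₀' : n₀ = p.1 * G.degree v₀ + p.2 := by exact_mod_cast h₀
      refine Prod.ext h₃ ?_
      simp only [h₀', h₃]
      ring
  · rintro ⟨p, hp, huniq⟩
    have hQ (v : V) := (sum_degree_neighborFinset_eq_iff _ _ _).1 (hp v)
    have hirreg (k : ℝ) : ¬ ∀ v, (G.degree v : ℝ) = k := by
      intro hk
      obtain ⟨v₀⟩ := hconn.nonempty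
      have := huniq (p.1 + 1, p.2 - G.degree v₀) fun v => by
        have hv : G.degree v = G.degree v₀ := by exact_mod_cast (hk v).trans (hk v₀).symm
        rw [hp v, hv]
        ring
      simpa using congrArg Prod.fst this
    have hex (μ : ℝ) : ∃ ν, IsQMainEigenvalue G ν ∧ ν ≠ μ := by
      by_contra! hall
      exact hirreg _ (degree_eq_of_forall_isQMainEigenvalue_eq hall)
    obtain ⟨μ, hμ, -⟩ := hex 0
    obtain ⟨ν, hν, hne⟩ := hex μ
    refine Set.ncard_eq_two.mpr ⟨μ, ν, hne.symm, Set.ext fun l => ⟨fun hl => ?_, ?_⟩⟩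
    · have hμ₂ := hμ.sq_eq hQ
      have hν₂ := hν.sq_eq hQ
      have hl₂ := IsQMainEigenvalue.sq_eq hl hQ
      have hsum : ν + μ = p.1 :=
        mul_left_cancel₀ (sub_ne_zero.mpr hne) (by linear_combination hν₂ - hμ₂)
      have : (l - μ) * (l - ν) = 0 := by
        linear_combination hl₂ - hμ₂ - (l - μ) * hsum
      simpa [sub_eq_zero] using this
    · rintro (rfl | rfl)
      exacts [hμ, hν]
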